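/- arXiv:1102.2558 — 5 statements merged into one kernel-verified Lean document; each statement's English description precedes it below -/
import Mathlib

section
/- Let S be a type, R a binary relation on S, and x : ℕ → S a sequence counted by the IPC procedure, producing pairs (α i, β i). If i < j and the 2-types agree, β i = β j, then the successor indices satisfy α j = α i + (j − i); that is, within a single 2-type the successor index grows by exactly the number of counting steps taken. -/
/-- **IPC (Indiscernible Predecessor based Primitive Counting).**
Given a relation `R` on `S` and a sequence `x : ℕ → S`, the IPC procedure
produces pairs `(α i, β i)` with `α 0 = 0`, `β 0 = 1`, and at each step:
if `R (x i) (x (i+1))` then `α (i+1) = 0` and `β (i+1) = β i + 1`,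
otherwise `α (i+1) = α i + 1` and `β (i+1) = β i`.
If `i < j` and the 2-types agree (`β i = β j`), then `α j = α i + (j - i)`. -/
theorem ipc_alpha_of_same_type {S : Type*} (R : S → S → Prop) (x : ℕ → S)
    (α β : ℕ → ℕ) (hα0 : α 0 = 0) (hβ0 : β 0 = 1)
    (hrel : ∀ i, R (x i) (x (i + 1)) → α (i + 1) = 0 ∧ β (i + 1) = β i + 1)
    (hnrel : ∀ i, ¬ R (x i) (x (i + 1)) → α (i + 1) = α i + 1 ∧ β (i + 1) = β i) :
    ∀ i j : ℕ, i < j → β i = β j → α j = α i + (j - i) := by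
  have hmono : Monotone β := monotone_nat_of_le_succ fun k => by
    by_cases h : R (x k) (x (k + 1))
    · exact (hrel k h).2 ▸ Nat.le_succ _
    · exact (hnrel k h).2.ge
  intro i j hij
  induction j, hij.le using Nat.le_induction with
  | base => exact absurd hij (lt_irrefl i)
  | succ k hik ih =>
    intro hβ
    have hβik := hmono hik
    by_cases h : R (x k) (x (k + 1))
    · have := (hrel k h).2
      omega
    · obtain ⟨hα', hβ'⟩ := hnrel k h
      rcases hik.eq_or_lt with rfl | hlt
      · omega
      · have := ih hlt (hβ.trans hβ')
        omega
end

section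
/- Let S be a type, R a binary relation on S, and x : ℕ → S a sequence counted by the IPC procedure, producing pairs (α i, β i). Then for every j, the successor index has the closed form α j = j − s, where s is the least index k with β k = β j (the starting index of the 2-type block containing j). -/
/-- In the IPC procedure, `j - α j` is an index of the 2-type block of `j`, and every smaller index
has a strictly smaller 2-type. -/
theorem ipc_block_start {S : Type*} (R : S → S → Prop) (x : ℕ → S)
    (α β : ℕ → ℕ) (hα0 : α 0 = 0)
    (hrel : ∀ i, R (x i) (x (i + 1)) → α (i + 1) = 0 ∧ β (i + 1) = β i + 1)
    (hnrel : ∀ i, ¬ R (x i) (x (i + 1)) → α (i + 1) = α i + 1 ∧ β (i + 1) = β i) (j : ℕ) :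
    β (j - α j) = β j ∧ ∀ k < j - α j, β k < β j := by
  have hmono : Monotone β := monotone_nat_of_le_succ fun i => by
    by_cases h : R (x i) (x (i + 1))
    · have := (hrel i h).2
      omega
    · exact (hnrel i h).2.ge
  induction j with
  | zero => simp [hα0]
  | succ j ih =>
    by_cases h : R (x j) (x (j + 1))
    · obtain ⟨hα, hβ⟩ := hrel j h
      rw [hα, hβ]
      refine ⟨hβ, fun k hk => ?_⟩
      have := hmono (show k ≤ j by omega)
      omega
    · obtain ⟨hα, hβ⟩ := hnrel j h
      rwa [hα, hβ, Nat.add_sub_add_right]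

/-- In the IPC procedure, the successor index never exceeds the index. -/
theorem ipc_alpha_le {S : Type*} (R : S → S → Prop) (x : ℕ → S)
    (α β : ℕ → ℕ) (hα0 : α 0 = 0)
    (hrel : ∀ i, R (x i) (x (i + 1)) → α (i + 1) = 0 ∧ β (i + 1) = β i + 1)
    (hnrel : ∀ i, ¬ R (x i) (x (i + 1)) → α (i + 1) = α i + 1 ∧ β (i + 1) = β i) (j : ℕ) :
    α j ≤ j := by
  induction j with
  | zero => exact hα0.le
  | succ j ih =>
    by_cases h : R (x j) (x (j + 1))
    · have := (hrel j h).1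
      omega
    · have := (hnrel j h).1
      omega

/-- **Closed form for the IPC successor index.**
Given a relation `R` on `S` and a sequence `x : ℕ → S`, the IPC procedure
produces pairs `(α i, β i)` with `α 0 = 0`, `β 0 = 1`, and at each step:
if `R (x i) (x (i+1))` then `α (i+1) = 0` and `β (i+1) = β i + 1`,
otherwise `α (i+1) = α i + 1` and `β (i+1) = β i`.
For every `j`, `α j = j - s` where `s` is the least index `k` with
`β k = β j` (the starting index of the 2-type block containing `j`). -/
theorem ipc_alpha_closed_form {S : Type*} (R : S → S → Prop) (x : ℕ → S)
    (α β : ℕ → ℕ) (hα0 : α 0 = 0) (hβ0 : β 0 = 1)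
    (hrel : ∀ i, R (x i) (x (i + 1)) → α (i + 1) = 0 ∧ β (i + 1) = β i + 1)
    (hnrel : ∀ i, ¬ R (x i) (x (i + 1)) → α (i + 1) = α i + 1 ∧ β (i + 1) = β i) :
    ∀ j : ℕ, α j = j - Nat.find (⟨j, rfl⟩ : ∃ k, β k = β j) := by
  intro j
  obtain ⟨heq, hlt⟩ := ipc_block_start R x α β hα0 hrel hnrel j
  have hle := ipc_alpha_le R x α β hα0 hrel hnrel j
  have hfind : Nat.find (⟨j, rfl⟩ : ∃ k, β k = β j) = j - α j :=
    (Nat.find_eq_iff _).2 ⟨heq, fun k hk => (hlt k hk).ne⟩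
  rw [hfind]
  omega
end

section
/- Let S be a finite set with n ≥ 1 elements, R an equivalence relation on S, and x : Fin n → S a bijective enumeration which is predecessor-coherent. Then a subset G ⊆ S is an R-equivalence class (granule) if and only if G is a maximal run of the enumeration, i.e., G = {x p, x (p+1), …, x t} for some p ≤ t with R (x k) (x (k+1)) for all p ≤ k < t, with ¬R (x (p−1)) (x p) if p > 0, and with ¬R (x t) (x (t+1)) if t + 1 < n. -/
/-- In a predecessor-coherent enumeration, every index between two related ones is related to
the later one. -/
theorem rel_of_le_of_le_of_predecessor_coherent {S : Type*} {n : ℕ}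
    {R : S → S → Prop} (hR : Equivalence R) {x : Fin n → S}
    (hcoh : ∀ i : ℕ, ∀ h : i + 1 < n,
      R (x ⟨i, Nat.lt_of_succ_lt h⟩) (x ⟨i + 1, h⟩) ∨
      ∀ j : ℕ, ∀ hj : j ≤ i, ¬ R (x ⟨i + 1, h⟩) (x ⟨j, hj.trans_lt (Nat.lt_of_succ_lt h)⟩))
    {i j k : ℕ} (hk : k < n) (hij : i ≤ j) (hjk : j ≤ k)
    (h : R (x ⟨i, (hij.trans hjk).trans_lt hk⟩) (x ⟨k, hk⟩)) :
    R (x ⟨j, hjk.trans_lt hk⟩) (x ⟨k, hk⟩) := by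
  induction k, hjk using Nat.le_induction with
  | base => exact hR.refl _
  | succ k hjk ih =>
    have hstep := (hcoh k hk).resolve_right fun hnot => hnot i (by omega) (hR.symm h)
    exact hR.trans (ih (by omega) (hR.trans h (hR.symm hstep))) hstep

/-- The first element of a run is related to each of its elements. -/
theorem rel_of_forall_rel_succ {S : Type*} {n : ℕ} {R : S → S → Prop} (hR : Equivalence R)
    {x : Fin n → S} {p t : ℕ} (ht : t < n)
    (hrun : ∀ k : ℕ, ∀ _ : p ≤ k, ∀ hkt : k < t,
      R (x ⟨k, hkt.trans ht⟩) (x ⟨k + 1, (Nat.succ_le_of_lt hkt).trans_lt ht⟩))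
    {k : ℕ} (hpk : p ≤ k) (hkt : k ≤ t) :
    R (x ⟨p, (hpk.trans hkt).trans_lt ht⟩) (x ⟨k, hkt.trans_lt ht⟩) := by
  induction k, hpk using Nat.le_induction with
  | base => exact hR.refl _
  | succ k hpk ih => exact hR.trans (ih (by omega)) (hrun k hpk hkt)

/-- **Granules are exactly the maximal runs of a predecessor-coherent enumeration.**
Let `S` have `n ≥ 1` elements, `R` be an equivalence relation on `S`, and
`x : Fin n → S` a bijective enumeration which is *predecessor-coherent*: for every
`i` with `i + 1 < n`, either `R (x i) (x (i+1))` holds, or `x (i+1)` is `R`-unrelated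
to `x j` for all `j ≤ i`.  Then a subset `G ⊆ S` is an `R`-equivalence class (granule)
iff `G = {x p, x (p+1), …, x t}` for some `p ≤ t < n` with `R (x k) (x (k+1))` for all
`p ≤ k < t`, with `¬R (x (p-1)) (x p)` if `p > 0` and `¬R (x t) (x (t+1))` if `t+1 < n`. -/
theorem granule_iff_maximal_run {S : Type*} {n : ℕ} (hn : 1 ≤ n)
    (R : S → S → Prop) (hR : Equivalence R)
    (x : Fin n → S) (hx : Function.Bijective x)
    (hcoh : ∀ i : ℕ, ∀ h : i + 1 < n,
      R (x ⟨i, by omega⟩) (x ⟨i + 1, h⟩) ∨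
      ∀ j : ℕ, ∀ hj : j ≤ i, ¬ R (x ⟨i + 1, h⟩) (x ⟨j, by omega⟩))
    (G : Set S) :
    (∃ a : S, G = {b | R a b}) ↔
      ∃ p t : ℕ, ∃ htn : t < n, ∃ hpt : p ≤ t,
        (G = {b | ∃ k : ℕ, ∃ hk : k < n, p ≤ k ∧ k ≤ t ∧ b = x ⟨k, hk⟩}) ∧
        (∀ k : ℕ, ∀ hk1 : p ≤ k, ∀ hk2 : k < t,
          R (x ⟨k, by omega⟩) (x ⟨k + 1, by omega⟩)) ∧
        (0 < p → ¬ R (x ⟨p - 1, by omega⟩) (x ⟨p, by omega⟩)) ∧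
        (∀ ht1 : t + 1 < n, ¬ R (x ⟨t, by omega⟩) (x ⟨t + 1, ht1⟩)) := by
  constructor
  · rintro ⟨a, rfl⟩
    classical
    obtain ⟨m, rfl⟩ := hx.surjective a
    let F : Finset (Fin n) := Finset.univ.filter fun k => R (x m) (x k)
    have hmem (k : Fin n) : k ∈ F ↔ R (x m) (x k) := by simp [F]
    have hne : F.Nonempty := ⟨m, (hmem m).2 (hR.refl _)⟩
    obtain ⟨p, hp, hmin⟩ : ∃ p ∈ F, ∀ k ∈ F, p ≤ k :=
      ⟨F.min' hne, F.min'_mem hne, fun k hk => F.min'_le k hk⟩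
    obtain ⟨t, ht, hmax⟩ : ∃ t ∈ F, ∀ k ∈ F, k ≤ t :=
      ⟨F.max' hne, F.max'_mem hne, fun k hk => F.le_max' k hk⟩
    rw [hmem] at hp ht
    have hbetween (k : ℕ) (hpk : (p : ℕ) ≤ k) (hkt : k ≤ t) : R (x m) (x ⟨k, by omega⟩) :=
      hR.trans ht (hR.symm (rel_of_le_of_le_of_predecessor_coherent hR hcoh t.2 hpk hkt
        (hR.trans (hR.symm hp) ht)))
    have hpt : p ≤ t := hmin t ((hmem t).2 ht)
    refine ⟨p, t, t.2, hpt, ?_, ?_, ?_, ?_⟩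
    · ext b
      constructor
      · intro hb
        obtain ⟨k, rfl⟩ := hx.surjective b
        exact ⟨k, k.2, hmin k ((hmem k).2 hb), hmax k ((hmem k).2 hb), rfl⟩
      · rintro ⟨k, hk, hpk, hkt, rfl⟩
        exact hbetween k hpk hkt
    · intro k hpk hkt
      exact hR.trans (hR.symm (hbetween k hpk hkt.le)) (hbetween (k + 1) (by omega) hkt)
    · intro hpos hrel
      have hle := hmin ⟨p - 1, by omega⟩ ((hmem _).2 (hR.trans hp (hR.symm hrel)))
      rw [Fin.le_def] at hle
      dsimp only at hle
      omega
    · intro ht1 hrel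
      have hle := hmax ⟨t + 1, ht1⟩ ((hmem _).2 (hR.trans ht hrel))
      rw [Fin.le_def] at hle
      dsimp only at hle
      omega
  · rintro ⟨p, t, htn, hpt, rfl, hrun, hfirst, hlast⟩
    refine ⟨x ⟨p, by omega⟩, ?_⟩
    ext b
    constructor
    · rintro ⟨k, hk, hpk, hkt, rfl⟩
      exact rel_of_forall_rel_succ hR htn hrun hpk hkt
    · intro hb
      obtain ⟨⟨k, hk⟩, rfl⟩ := hx.surjective b
      refine ⟨k, hk, ?_, ?_, rfl⟩
      · by_contra! hkp
        exact hfirst (by omega) (rel_of_le_of_le_of_predecessor_coherent hR hcoh (i := k)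
          (by omega) (by omega) (by omega) (hR.symm hb))
      · by_contra! htk
        have h₁ := rel_of_le_of_le_of_predecessor_coherent hR hcoh hk hpt htk.le hb
        have h₂ := rel_of_le_of_le_of_predecessor_coherent hR hcoh hk t.le_succ htk h₁
        exact hlast (by omega) (hR.trans h₁ (hR.symm h₂))
end

section
/- Let S be a finite set with n ≥ 1 elements, R an equivalence relation on S with exactly c equivalence classes, and x : Fin n → S a bijective enumeration. Then the number of consecutive related pairs, card {i : i + 1 < n ∧ R (x i) (x (i+1))}, is at most n − c. -/
/-- **Bound on consecutive related pairs.**  Let `S` have `n ≥ 1` elements, `r` an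
equivalence relation on `S` with exactly `c` equivalence classes, and `x : Fin n → S`
a bijective enumeration.  Then the number of consecutive related pairs, i.e. of
indices `i` with `i + 1 < n` and `r (x i) (x (i+1))`, is at most `n - c`. -/
theorem consecutive_related_pairs_le {S : Type*} {n c : ℕ} (hn : 1 ≤ n)
    (r : Setoid S) (hc : Nat.card (Quotient r) = c)
    (x : Fin n → S) (hx : Function.Bijective x) :
    {i : ℕ | ∃ h : i + 1 < n, r.r (x ⟨i, by omega⟩) (x ⟨i + 1, h⟩)}.ncard ≤ n - c := by
  set A : Set ℕ := {i : ℕ | ∃ h : i + 1 < n, r.r (x ⟨i, by omega⟩) (x ⟨i + 1, h⟩)}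
  have hlast : ∀ q : Quotient r, ∃ j : Fin n, Quotient.mk r (x j) = q ∧ (j : ℕ) ∉ A := by
    intro q
    obtain ⟨s, rfl⟩ := Quotient.exists_rep q
    obtain ⟨i, rfl⟩ := hx.2 s
    obtain ⟨j, hj, hmax⟩ := Set.exists_max_image
      {j : Fin n | Quotient.mk r (x j) = Quotient.mk r (x i)}
      id (Set.toFinite _) ⟨i, rfl⟩
    refine ⟨j, hj, ?_⟩
    rintro ⟨h, hr⟩
    have hle : (⟨(j : ℕ) + 1, h⟩ : Fin n) ≤ j :=
      hmax ⟨(j : ℕ) + 1, h⟩ ((Quotient.sound hr).symm.trans hj)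
    have : (j : ℕ) + 1 ≤ j := hle
    omega
  choose f hf hfA using hlast
  have hAn : A ⊆ Set.Iio n := by
    rintro i ⟨h, -⟩
    exact Set.mem_Iio.2 (by omega)
  have hcard : c ≤ (Set.Iio n \ A).ncard := by
    have hfin : Finite ↥(Set.Iio n \ A) := ((Set.finite_Iio n).sdiff).to_subtype
    rw [← hc, ← Nat.card_coe_set_eq]
    refine Nat.card_le_card_of_injective
      (fun q => (⟨f q, (f q).isLt, hfA q⟩ : ↥(Set.Iio n \ A))) fun p q hpq => ?_
    have hpq' : f p = f q := Fin.ext (congrArg Subtype.val hpq)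
    rw [← hf p, ← hf q, hpq']
  have hsum := Set.ncard_sdiff_add_ncard_of_subset hAn (Set.finite_Iio n)
  have hn' : (Set.Iio n).ncard = n := by simp [Set.ncard_eq_toFinset_card']
  omega
end

section
/- Let S be a finite set with n ≥ 1 elements, R an equivalence relation on S with exactly c equivalence classes, and x : Fin n → S a bijective enumeration. Then the number of consecutive related pairs equals n − c if and only if every R-equivalence class is an interval of the enumeration, i.e., for all indices i ≤ j ≤ k, if R (x i) (x k) then R (x i) (x j). (Such enumerations are exactly those whose IPC counts have the maximum number of indiscernibility steps and hence determine all granules.) -/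
/-- The block starts of `f`: the indices whose predecessor, if any, has a different value. -/
def blockStarts {α : Type*} {n : ℕ} (f : Fin n → α) : Set (Fin n) :=
  {i | ∀ j : Fin n, (j : ℕ) + 1 = i → f j ≠ f i}

theorem exists_blockStart_le {α : Type*} {n : ℕ} (f : Fin n → α) (k : Fin n) :
    ∃ b ∈ blockStarts f, b ≤ k ∧ ∀ j, b ≤ j → j ≤ k → f j = f k := by
  obtain ⟨k, hk⟩ := k
  induction k with
  | zero =>
    refine ⟨⟨0, hk⟩, fun j hj => by simp at hj, le_rfl, fun j h₁ h₂ => ?_⟩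
    rw [le_antisymm h₂ h₁]
  | succ k ih =>
    by_cases hs : (⟨k + 1, hk⟩ : Fin n) ∈ blockStarts f
    · refine ⟨_, hs, le_rfl, fun j h₁ h₂ => ?_⟩
      rw [le_antisymm h₂ h₁]
    · have heq : f ⟨k, by omega⟩ = f ⟨k + 1, hk⟩ := by
        simp only [blockStarts, Set.mem_ofPred_eq, not_forall, not_not] at hs
        obtain ⟨j, hj, hfj⟩ := hs
        rwa [show j = ⟨k, by omega⟩ from Fin.ext (Nat.succ.inj hj)] at hfj
      obtain ⟨b, hb, hbk, hconst⟩ := ih (by omega)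
      refine ⟨b, hb, hbk.trans (Fin.mk_le_mk.2 k.le_succ), fun j h₁ h₂ => ?_⟩
      rcases h₂.eq_or_lt with rfl | h
      · rfl
      · exact (hconst j h₁ (Fin.le_def.2 (Nat.lt_succ_iff.1 (Fin.lt_def.1 h)))).trans heq

theorem image_blockStarts {α : Type*} {n : ℕ} (f : Fin n → α) :
    f '' blockStarts f = Set.range f := by
  refine (Set.image_subset_range _ _).antisymm ?_
  rintro _ ⟨k, rfl⟩
  obtain ⟨b, hb, hbk, hconst⟩ := exists_blockStart_le f k
  exact ⟨b, hb, hconst b le_rfl hbk⟩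

theorem injOn_blockStarts_iff {α : Type*} {n : ℕ} (f : Fin n → α) :
    Set.InjOn f (blockStarts f) ↔ ∀ i j k : Fin n, i ≤ j → j ≤ k → f i = f k → f i = f j := by
  constructor
  · intro hinj i j k hij hjk hik
    obtain ⟨b, hb, hbi, hconst⟩ := exists_blockStart_le f i
    obtain ⟨b', hb', hbk, hconst'⟩ := exists_blockStart_le f k
    have hbb : b = b' := hinj hb hb' <| by
      rw [hconst b le_rfl hbi, hconst' b' le_rfl hbk, hik]
    rw [hik, hconst' j (hbb ▸ hbi.trans hij) hjk]
  · intro hint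
    have key : ∀ b b' : Fin n, b' ∈ blockStarts f → f b = f b' → b' ≤ b := by
      intro b b' hb' h
      by_contra! hlt
      have hlt' := Fin.lt_def.1 hlt
      let j : Fin n := ⟨b' - 1, by omega⟩
      have hj : (j : ℕ) + 1 = b' := by simp only [j]; omega
      exact hb' j hj ((hint b j b' (Fin.le_def.2 (by omega)) (Fin.le_def.2 (by omega)) h).symm.trans
        h)
    exact fun b hb b' hb' h => (key b' b hb h.symm).antisymm (key b b' hb' h)

theorem ncard_consecutive_eq_add_ncard_blockStarts {α : Type*} {n : ℕ} (f : Fin n → α) :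
    {i : ℕ | ∃ h : i + 1 < n, f ⟨i, by omega⟩ = f ⟨i + 1, h⟩}.ncard + (blockStarts f).ncard
      = n := by
  have himage : (· + 1) '' {i : ℕ | ∃ h : i + 1 < n, f ⟨i, by omega⟩ = f ⟨i + 1, h⟩} =
      Fin.val '' (blockStarts f)ᶜ := by
    ext m
    simp only [blockStarts, Set.mem_image, Set.mem_ofPred_eq, Set.mem_compl_iff, not_forall, not_not]
    constructor
    · rintro ⟨i, ⟨h, hf⟩, rfl⟩
      exact ⟨⟨i + 1, h⟩, ⟨⟨i, by omega⟩, rfl, hf⟩, rfl⟩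
    · rintro ⟨⟨k, hk⟩, ⟨⟨j, hj⟩, hjk, hf⟩, rfl⟩
      dsimp only at hjk
      subst hjk
      exact ⟨j, ⟨hk, hf⟩, rfl⟩
  rw [← Set.ncard_image_of_injective _ (add_left_injective 1), himage,
    Set.ncard_image_of_injective _ Fin.val_injective, add_comm, Set.ncard_add_ncard_compl,
    Nat.card_fin]

/-- **Maximal enumerations determine all granules.**  Let `S` have `n ≥ 1` elements,
`r` an equivalence relation on `S` with exactly `c` equivalence classes, and
`x : Fin n → S` a bijective enumeration.  Then the number of consecutive related
pairs equals `n - c` iff every equivalence class is an interval of the enumeration: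
for all `i ≤ j ≤ k`, `r (x i) (x k)` implies `r (x i) (x j)`. -/
theorem consecutive_related_pairs_eq_iff {S : Type*} {n c : ℕ} (hn : 1 ≤ n)
    (r : Setoid S) (hc : Nat.card (Quotient r) = c)
    (x : Fin n → S) (hx : Function.Bijective x) :
    {i : ℕ | ∃ h : i + 1 < n, r.r (x ⟨i, by omega⟩) (x ⟨i + 1, h⟩)}.ncard = n - c ↔
      ∀ i j k : Fin n, i ≤ j → j ≤ k → r.r (x i) (x k) → r.r (x i) (x j) := by
  let f : Fin n → Quotient r := fun i => Quotient.mk r (x i)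
  have hr : ∀ i j, r.r (x i) (x j) ↔ f i = f j := fun i j => Quotient.eq.symm
  have hrange : Set.range f = Set.univ := (Quotient.mk_surjective.comp hx.surjective).range_eq
  have himage : (f '' blockStarts f).ncard = c := by
    rw [image_blockStarts, hrange, Set.ncard_univ, hc]
  have hle : c ≤ (blockStarts f).ncard := himage ▸ Set.ncard_image_le
  have hsum := ncard_consecutive_eq_add_ncard_blockStarts f
  simp only [hr]
  rw [← injOn_blockStarts_iff, ← Set.ncard_image_iff, himage]
  omega
end
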